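/- Let T be a finite tree such that the eccentric graph E(T) contains a cycle, and let S be a finite tree on at least 3 vertices such that the eccentric graph E(S) is acyclic. Then the girth of the eccentric graph E(T □ S) equals 4. -/

import Mathlib

open SimpleGraph

/-- The eccentricity of a vertex `v`: the max distance from `v` to any vertex. -/
noncomputable def ecc {V : Type*} [Fintype V] (G : SimpleGraph V) (v : V) : ℕ :=
  Finset.univ.sup fun u => G.dist v u

/-- `u` is eccentric to `v` in `G` if `d(v,u) = e(v)`. -/
def IsEccentric {V : Type*} [Fintype V] (G : SimpleGraph V) (v u : V) : Prop :=
  G.dist v u = ecc G v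

/-- The eccentric graph of `G`: distinct `u, v` adjacent iff one is eccentric to the other. -/
noncomputable def eccGraph {V : Type*} [Fintype V] (G : SimpleGraph V) : SimpleGraph V :=
  SimpleGraph.fromRel fun u v => IsEccentric G u v

/-- The diameter of `G`: the maximum eccentricity. -/
noncomputable def gdiam {V : Type*} [Fintype V] (G : SimpleGraph V) : ℕ :=
  Finset.univ.sup fun v => ecc G v

namespace SimpleGraph

variable {V : Type*} {G : SimpleGraph V}

lemma Connected.exists_adj_dist_eq_of_dist_eq_succ (hG : G.Connected) {x z : V} {n : ℕ}
    (h : G.dist x z = n + 1) : ∃ y, G.Adj x y ∧ G.dist y z = n := by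
  obtain ⟨w, hw⟩ := hG.exists_walk_length_eq_dist x z
  cases w with
  | nil => simp at h
  | @cons _ y _ hadj w =>
    refine ⟨y, hadj, ?_⟩
    have h₁ := dist_le w
    have h₂ := hG.dist_triangle (u := x) (v := y) (w := z)
    have h₃ := dist_eq_one_iff_adj.mpr hadj
    rw [Walk.length_cons] at hw
    lia

lemma IsTree.eq_of_adj_of_dist_eq_dist_add_one (hG : G.IsTree) {u v y z : V}
    (hy : G.Adj y v) (hz : G.Adj z v) (huy : G.dist u v = G.dist u y + 1)
    (huz : G.dist u v = G.dist u z + 1) : y = z := by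
  obtain ⟨p, hp⟩ := hG.connected.exists_walk_length_eq_dist u y
  obtain ⟨q, hq⟩ := hG.connected.exists_walk_length_eq_dist u z
  have hp' : (p.concat hy).IsPath :=
    Walk.isPath_of_length_eq_dist _ (by rw [Walk.length_concat, hp, huy])
  have hq' : (q.concat hz).IsPath :=
    Walk.isPath_of_length_eq_dist _ (by rw [Walk.length_concat, hq, huz])
  have h := congrArg Walk.penultimate ((hG.existsUnique_path u v).unique hp' hq')
  simpa using h

/-- In a tree, walking across an edge away from `p` and then further on to `z` never turns back
towards `p`. -/
lemma IsTree.dist_eq_add_of_adj (hG : G.IsTree) (p z : V) {n : ℕ} {x y : V} (hadj : G.Adj x y)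
    (hy : G.dist y z = n) (hx : G.dist x z = n + 1) (hp : G.dist p y = G.dist p x + 1) :
    G.dist p z = G.dist p x + 1 + n := by
  induction n generalizing x y with
  | zero =>
    obtain rfl := hG.connected.dist_eq_zero_iff.mp hy
    lia
  | succ n ih =>
    obtain ⟨w, hw, hwz⟩ := hG.connected.exists_adj_dist_eq_of_dist_eq_succ hy
    rcases hG.dist_eq_dist_add_one_of_adj p hw with h | h
    · obtain rfl := hG.eq_of_adj_of_dist_eq_dist_add_one hadj hw.symm hp h
      lia
    · have := ih hw hwz hy h
      lia

/-- The four-point condition for the metric of a tree. -/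
theorem IsTree.dist_add_dist_le_max (hG : G.IsTree) (x z p q : V) :
    G.dist x z + G.dist p q ≤
      max (G.dist p x + G.dist q z) (G.dist q x + G.dist p z) := by
  obtain ⟨n, hn⟩ : ∃ n, G.dist x z = n := ⟨_, rfl⟩
  induction n generalizing x with
  | zero =>
    have := hG.connected.dist_triangle (u := p) (v := x) (w := q)
    obtain rfl := hG.connected.dist_eq_zero_iff.mp hn
    simp only [G.dist_comm (u := q) (v := x), dist_self] at *
    lia
  | succ n ih =>
    obtain ⟨y, hxy, hyz⟩ := hG.connected.exists_adj_dist_eq_of_dist_eq_succ hn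
    have key := ih y hyz
    have htri := hG.connected.dist_triangle (u := p) (v := x) (w := q)
    rw [G.dist_comm (u := x) (v := q)] at htri
    rcases hG.dist_eq_dist_add_one_of_adj p hxy with hp | hp <;>
    rcases hG.dist_eq_dist_add_one_of_adj q hxy with hq | hq
    · lia
    · have := hG.dist_eq_add_of_adj q z hxy hyz hn hq
      lia
    · have := hG.dist_eq_add_of_adj p z hxy hyz hn hp
      lia
    · have := hG.dist_eq_add_of_adj p z hxy hyz hn hp
      lia

lemma Walk.IsCycle.exists_mem_support_ne {u : V} {c : G.Walk u u} (hc : c.IsCycle) (p q : V) :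
    ∃ x ∈ c.support, x ≠ p ∧ x ≠ q := by
  classical
  by_contra! h
  have hsub : c.support.tail.toFinset ⊆ {p, q} := by
    intro x hx
    have := h x (List.mem_of_mem_tail (List.mem_toFinset.mp hx))
    rw [Finset.mem_insert, Finset.mem_singleton]
    tauto
  have h₁ := Finset.card_le_card hsub
  rw [List.toFinset_card_of_nodup hc.support_nodup, List.length_tail, Walk.length_support] at h₁
  have h₂ := hc.three_le_length
  have h₃ := Finset.card_le_two (a := p) (b := q)
  lia

/-- Every cycle has a vertex outside `{p, q}`, and that vertex has two distinct neighbours. -/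
lemma isAcyclic_of_forall_ne_neighbor_unique (p q : V)
    (h : ∀ x, x ≠ p → x ≠ q → ∀ y z, G.Adj x y → G.Adj x z → y = z) : G.IsAcyclic := by
  classical
  intro u c hc
  obtain ⟨x, hx, hxp, hxq⟩ := hc.exists_mem_support_ne p q
  have hr := hc.rotate hx
  exact hr.snd_ne_penultimate (h x hxp hxq _ _ (Walk.adj_snd hr.not_nil)
    (Walk.adj_penultimate hr.not_nil).symm)

lemma egirth_le_four {a b c d : V} (hab : G.Adj a b) (hbc : G.Adj b c) (hcd : G.Adj c d)
    (hda : G.Adj d a) (hac : a ≠ c) (hbd : b ≠ d) : G.egirth ≤ 4 := by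
  have hc : (Walk.cons hab (.cons hbc (.cons hcd (.cons hda .nil)))).IsCycle := by
    have := hab.ne
    have := hbc.ne
    have := hcd.ne
    have := hda.ne
    rw [Walk.cons_isCycle_iff]
    simp
    grind
  simpa using egirth_le_length hc

lemma CliqueFree.four_le_egirth (h : G.CliqueFree 3) : 4 ≤ G.egirth := by
  rw [le_egirth]
  intro a w hw
  by_contra! hlt
  have hlt' : w.length < 4 := by exact_mod_cast hlt
  have hlen := hw.three_le_length
  match w, hlt', hlen with
  | .cons h₁ (.cons h₂ (.cons h₃ .nil)), _, _ =>
    classical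
    exact h _ (is3Clique_triple_iff.mpr ⟨h₁, h₃.symm, h₂⟩)
  | .cons _ (.cons _ (.cons _ (.cons _ _))), h, _ =>
    simp only [Walk.length_cons] at h
    lia
  | .cons _ (.cons _ .nil), _, h => simp at h
  | .cons _ .nil, _, h => simp at h
  | .nil, _, h => simp at h

lemma Connected.dist_boxProd {W : Type*} {H : SimpleGraph W} (hG : G.Connected)
    (hH : H.Connected) (x y : V × W) :
    (G □ H).dist x y = G.dist x.1 y.1 + H.dist x.2 y.2 := by
  have h := edist_boxProd (G := G) (H := H) x y
  rw [← ((hG.boxProd hH).preconnected x y).coe_dist_eq_edist,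
    ← (hG.preconnected x.1 y.1).coe_dist_eq_edist,
    ← (hH.preconnected x.2 y.2).coe_dist_eq_edist] at h
  exact_mod_cast h

end SimpleGraph

section Eccentric

variable {V W : Type*} [Fintype V] [Fintype W] {G : SimpleGraph V} {H : SimpleGraph W}

lemma dist_le_ecc (G : SimpleGraph V) (v u : V) : G.dist v u ≤ ecc G v :=
  Finset.le_sup (f := fun u => G.dist v u) (Finset.mem_univ u)

lemma exists_isEccentric (G : SimpleGraph V) (v : V) : ∃ u, IsEccentric G v u := by
  obtain ⟨u, -, hu⟩ := Finset.exists_mem_eq_sup Finset.univ ⟨v, Finset.mem_univ v⟩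
    fun u => G.dist v u
  exact ⟨u, hu.symm⟩

lemma isEccentric_iff {v u : V} : IsEccentric G v u ↔ ∀ w, G.dist v w ≤ G.dist v u := by
  refine ⟨fun h w => (dist_le_ecc G v w).trans_eq h.symm, fun h => ?_⟩
  exact (dist_le_ecc G v u).antisymm (Finset.sup_le fun w _ => h w)

lemma IsEccentric.ne [Nontrivial V] (hG : G.Connected) {v u : V} (h : IsEccentric G v u) :
    v ≠ u := by
  rintro rfl
  obtain ⟨w, hw⟩ := exists_ne v
  have h₁ := isEccentric_iff.mp h w
  have h₂ := hG.pos_dist_of_ne hw.symm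
  rw [dist_self] at h₁
  lia

lemma eccGraph_adj {u v : V} :
    (eccGraph G).Adj u v ↔ u ≠ v ∧ (IsEccentric G u v ∨ IsEccentric G v u) :=
  SimpleGraph.fromRel_adj _ _ _

lemma IsEccentric.adj [Nontrivial V] (hG : G.Connected) {v u : V} (h : IsEccentric G v u) :
    (eccGraph G).Adj v u :=
  eccGraph_adj.mpr ⟨h.ne hG, .inl h⟩

lemma isEccentric_boxProd_iff (hG : G.Connected) (hH : H.Connected) {x y : V × W} :
    IsEccentric (G □ H) x y ↔ IsEccentric G x.1 y.1 ∧ IsEccentric H x.2 y.2 := by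
  simp only [isEccentric_iff, hG.dist_boxProd hH]
  refine ⟨fun h => ⟨fun w => ?_, fun w => ?_⟩, fun h w => add_le_add (h.1 w.1) (h.2 w.2)⟩
  · have := h (w, y.2)
    lia
  · have := h (y.1, w)
    lia

/-- The second projection is a homomorphism of eccentric graphs. -/
def eccGraphBoxProdHom [Nontrivial W] (hG : G.Connected) (hH : H.Connected) :
    eccGraph (G □ H) →g eccGraph H where
  toFun := Prod.snd
  map_rel' := by
    intro x y h
    rcases (eccGraph_adj.mp h).2 with h | h
    · exact ((isEccentric_boxProd_iff hG hH).mp h).2.adj hH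
    · exact (((isEccentric_boxProd_iff hG hH).mp h).2.adj hH).symm

/-- In a tree, one of the ends of any longest path is eccentric to a given vertex. -/
lemma SimpleGraph.IsTree.exists_pair_isEccentric (hG : G.IsTree) :
    ∃ p q, ∀ x, IsEccentric G x p ∨ IsEccentric G x q := by
  have := hG.connected.nonempty
  obtain ⟨⟨p, q⟩, hpq⟩ := Finite.exists_max fun x : V × V => G.dist x.1 x.2
  refine ⟨p, q, fun x => ?_⟩
  obtain ⟨z, hz⟩ := exists_isEccentric G x
  rw [isEccentric_iff] at hz
  have h := hG.dist_add_dist_le_max x z p q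
  have h₁ := hpq (p, z)
  have h₂ := hpq (q, z)
  simp only [G.dist_comm (v := x)] at h h₁ h₂
  simp only [isEccentric_iff]
  by_cases hle : G.dist x z ≤ G.dist x p
  · exact .inl fun w => (hz w).trans hle
  · exact .inr fun w => (hz w).trans (by lia)

lemma SimpleGraph.IsTree.exists_two_isEccentric_of_not_isAcyclic (hG : G.IsTree)
    (hcyc : ¬ (eccGraph G).IsAcyclic) :
    ∃ x a b, a ≠ b ∧ IsEccentric G x a ∧ IsEccentric G x b := by
  by_contra! hu
  obtain ⟨p, q, hpq⟩ := hG.exists_pair_isEccentric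
  have huniq : ∀ x a b, IsEccentric G x a → IsEccentric G x b → a = b := fun x a b ha hb =>
    by_contra fun hab => hu x a b hab ha hb
  have hnot : ∀ x y, x ≠ p → x ≠ q → ¬ IsEccentric G y x := by
    intro x y hxp hxq hyx
    rcases hpq y with h | h
    · exact hxp (huniq y _ _ hyx h)
    · exact hxq (huniq y _ _ hyx h)
  refine hcyc (isAcyclic_of_forall_ne_neighbor_unique p q fun x hxp hxq y z hy hz => ?_)
  exact huniq x y z ((eccGraph_adj.mp hy).2.resolve_right (hnot x y hxp hxq))
    ((eccGraph_adj.mp hz).2.resolve_right (hnot x z hxp hxq))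

/-- A leaf of a tree and its neighbour share an eccentric vertex. -/
lemma SimpleGraph.IsTree.exists_common_isEccentric (hG : G.IsTree) (hcard : 3 ≤ Fintype.card V) :
    ∃ x y u, x ≠ y ∧ IsEccentric G x u ∧ IsEccentric G y u := by
  classical
  have : Nontrivial V := Fintype.one_lt_card_iff_nontrivial.mp (by lia)
  obtain ⟨l, hl⟩ := hG.exists_vert_degree_one_of_nontrivial
  obtain ⟨n, hln, hn⟩ := degree_eq_one_iff_existsUnique_adj.mp hl
  have hdist : ∀ w, w ≠ l → G.dist l w = G.dist n w + 1 := by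
    intro w hw
    obtain ⟨k, hk⟩ := Nat.exists_eq_add_one.mpr (hG.connected.pos_dist_of_ne hw.symm)
    obtain ⟨y, hly, hy⟩ := hG.connected.exists_adj_dist_eq_of_dist_eq_succ hk
    rw [← hn y hly, hy, hk]
  obtain ⟨v, hvl, hvn⟩ : ∃ v, v ≠ l ∧ v ≠ n := by
    obtain ⟨v, hv⟩ := Finset.exists_mem_notMem_of_card_lt_card (s := {l, n}) (t := Finset.univ)
      (Finset.card_le_two.trans_lt (by rwa [Finset.card_univ]))
    exact ⟨v, by simpa using hv⟩
  obtain ⟨u, hu⟩ := exists_isEccentric G l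
  refine ⟨l, n, u, hln.ne, hu, isEccentric_iff.mpr fun w => ?_⟩
  have hul := hdist u (hu.ne hG.connected).symm
  rw [isEccentric_iff] at hu
  by_cases hw : w = l
  · have h₁ := dist_eq_one_iff_adj.mpr hln.symm
    have h₂ := hu v
    have h₃ := hdist v hvl
    have h₄ := hG.connected.pos_dist_of_ne hvn.symm
    rw [hw]
    lia
  · have h₁ := hu w
    have h₂ := hdist w hw
    lia

end Eccentric

/-- If `T` is a tree whose eccentric graph contains a cycle and `S` is a tree on at least 3
vertices whose eccentric graph is acyclic, then the eccentric graph of `T □ S` has girth 4. -/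
theorem stmt_11 {α β : Type*} [Fintype α] [Fintype β]
    (T : SimpleGraph α) (S : SimpleGraph β) (hT : T.IsTree) (hS : S.IsTree)
    (hTcyc : ¬ (eccGraph T).IsAcyclic)
    (hcardS : 3 ≤ Fintype.card β) (hSacyc : (eccGraph S).IsAcyclic) :
    (eccGraph (T.boxProd S)).egirth = 4 := by
  have : Nontrivial β := Fintype.one_lt_card_iff_nontrivial.mp (by lia)
  refine le_antisymm ?_ ?_
  · obtain ⟨c, a, b, hab, hca, hcb⟩ := hT.exists_two_isEccentric_of_not_isAcyclic hTcyc
    obtain ⟨x, y, u, hxy, hxu, hyu⟩ := hS.exists_common_isEccentric hcardS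
    have hadj : ∀ {d z}, IsEccentric T c d → IsEccentric S z u →
        (eccGraph (T □ S)).Adj (c, z) (d, u) := fun hd hz =>
      eccGraph_adj.mpr ⟨fun h => hz.ne hS.connected (congrArg Prod.snd h),
        .inl ((isEccentric_boxProd_iff hT.connected hS.connected).mpr ⟨hd, hz⟩)⟩
    exact egirth_le_four (hadj hca hxu) (hadj hca hyu).symm (hadj hcb hyu) (hadj hcb hxu).symm
      (fun h => hxy (congrArg Prod.snd h)) (fun h => hab (congrArg Prod.fst h))
  · have hcol := hSacyc.colorable_two.of_hom (eccGraphBoxProdHom hT.connected hS.connected)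
    exact (hcol.cliqueFree (by lia)).four_le_egirth
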